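/- Let f : (0,∞) → ℝ admit the representation f(t) = a + b·t + ∫₀^∞ (tλ)/(t+λ) dw(λ) for all t > 0, where a ∈ ℝ, b ≥ 0 and w is a positive measure on (0,∞) with ∫₀^∞ λ/(1+λ) dw(λ) < ∞. Then for all strictly positive operators A, B, C, D on a complex Hilbert space H, 𝒫_f(A,B) − 𝒫_f(C,D) = b(A − C) + a(B − D) + ∫₀^∞ λ² [ ∫₀¹ B((1−t)C + tA + λB)⁻¹ (A − C) ((1−t)C + tA + λB)⁻¹ B dt ] dw(λ) + ∫₀^∞ λ [ ∫₀¹ C (C + λ((1−t)D + tB))⁻¹ (B − D) (C + λ((1−t)D + tB))⁻¹ C dt ] dw(λ). -/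

import Mathlib

open MeasureTheory

variable {H : Type*} [NormedAddCommGroup H] [InnerProductSpace ℂ H] [CompleteSpace H]

/-- An operator `T` on a complex Hilbert space is *strictly positive* if
`⟪T x, x⟫ ≥ 0` for all `x` and `T` is invertible. -/
def StrictlyPos (T : H →L[ℂ] H) : Prop := T.IsPositive ∧ IsUnit T

/-- `A^{1/2}` via the continuous functional calculus. -/
noncomputable def opSqrt (A : H →L[ℂ] H) : H →L[ℂ] H := cfc Real.sqrt A

/-- `A^{-1/2}` via the continuous functional calculus. -/
noncomputable def opInvSqrt (A : H →L[ℂ] H) : H →L[ℂ] H :=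
  cfc (fun x : ℝ => (Real.sqrt x)⁻¹) A

/-- The noncommutative perspective `𝒫_f(B, A) := A^{1/2} f(A^{-1/2} B A^{-1/2}) A^{1/2}`. -/
noncomputable def persp (f : ℝ → ℝ) (B A : H →L[ℂ] H) : H →L[ℂ] H :=
  opSqrt A * cfc f (opInvSqrt A * B * opInvSqrt A) * opSqrt A

/-- The weighted operator geometric mean `A ♯_ν B := A^{1/2} (A^{-1/2} B A^{-1/2})^ν A^{1/2}`. -/
noncomputable def gmean (ν : ℝ) (A B : H →L[ℂ] H) : H →L[ℂ] H :=
  opSqrt A * cfc (fun x : ℝ => x ^ ν) (opInvSqrt A * B * opInvSqrt A) * opSqrt A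

/-- The relative operator entropy `S(A|B) := A^{1/2} ln(A^{-1/2} B A^{-1/2}) A^{1/2}`. -/
noncomputable def relEntropy (A B : H →L[ℂ] H) : H →L[ℂ] H :=
  opSqrt A * cfc Real.log (opInvSqrt A * B * opInvSqrt A) * opSqrt A

section segmentInverse

variable {R : Type*} [NormedRing R] [NormedAlgebra ℝ R] [CompleteSpace R]

theorem hasDerivAt_ringInverse_segment (x y : R) (t : ℝ) (h : IsUnit ((1 - t) • x + t • y)) :
    HasDerivAt (fun s : ℝ => Ring.inverse ((1 - s) • x + s • y))
      (-(Ring.inverse ((1 - t) • x + t • y) * (y - x) *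
        Ring.inverse ((1 - t) • x + t • y))) t := by
  have hp : HasDerivAt (fun s : ℝ => (1 - s) • x + s • y) (y - x) t := by
    have h1 := (((hasDerivAt_id t).const_sub 1).smul_const x).add
      ((hasDerivAt_id t).smul_const y)
    refine h1.congr_deriv ?_
    simp only [neg_smul, one_smul]
    abel
  obtain ⟨u, hu⟩ := h
  have hi := hasFDerivAt_ringInverse (𝕜 := ℝ) u
  rw [hu] at hi
  refine (hi.comp_hasDerivAt t hp).congr_deriv ?_
  simp [← hu]

theorem integral_ringInverse_segment (x y p q : R)
    (h : ∀ t ∈ Set.Icc (0 : ℝ) 1, IsUnit ((1 - t) • x + t • y)) :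
    ∫ t in (0 : ℝ)..1, p * Ring.inverse ((1 - t) • x + t • y) * (y - x) *
        Ring.inverse ((1 - t) • x + t • y) * q =
      p * Ring.inverse x * q - p * Ring.inverse y * q := by
  have hder := fun t ht => hasDerivAt_ringInverse_segment x y t (h t ht)
  have hc : ContinuousOn (fun s : ℝ => Ring.inverse ((1 - s) • x + s • y)) (Set.Icc 0 1) :=
    fun t ht => (hder t ht).continuousAt.continuousWithinAt
  rw [← Set.uIcc_of_le zero_le_one] at hc hder
  rw [intervalIntegral.integral_eq_sub_of_hasDerivAt
    (f := fun s : ℝ => -(p * Ring.inverse ((1 - s) • x + s • y) * q))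
    (fun t ht => (((hder t ht).const_mul p).mul_const q).neg.congr_deriv (by noncomm_ring))
    (ContinuousOn.intervalIntegrable <| by
      fun_prop)]
  simp only [sub_self, zero_smul, one_smul, zero_add, sub_zero, add_zero]
  abel

end segmentInverse

namespace StrictlyPos

theorem isStrictlyPositive {A : H →L[ℂ] H} (hA : StrictlyPos A) : IsStrictlyPositive A :=
  ⟨(ContinuousLinearMap.nonneg_iff_isPositive A).2 hA.1, hA.2⟩

theorem of_isStrictlyPositive {A : H →L[ℂ] H} (hA : IsStrictlyPositive A) : StrictlyPos A :=
  ⟨(ContinuousLinearMap.nonneg_iff_isPositive A).1 hA.1, hA.2⟩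

theorem add {A B : H →L[ℂ] H} (hA : StrictlyPos A) (hB : StrictlyPos B) :
    StrictlyPos (A + B) :=
  of_isStrictlyPositive (hA.isStrictlyPositive.add_nonneg hB.isStrictlyPositive.nonneg)

theorem smul {A : H →L[ℂ] H} (hA : StrictlyPos A) {r : ℝ} (hr : 0 < r) :
    StrictlyPos (r • A) :=
  of_isStrictlyPositive ⟨smul_nonneg hr.le hA.isStrictlyPositive.nonneg,
    hA.2.smul (Units.mk0 r hr.ne')⟩

theorem convexComb {A B : H →L[ℂ] H} (hA : StrictlyPos A) (hB : StrictlyPos B) {t : ℝ}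
    (ht : t ∈ Set.Icc (0 : ℝ) 1) : StrictlyPos ((1 - t) • A + t • B) := by
  rcases ht.1.eq_or_lt with rfl | h0
  · simpa using hA
  rcases ht.2.eq_or_lt with rfl | h1
  · simpa using hB
  exact (hA.smul (sub_pos.2 h1)).add (hB.smul h0)

theorem spectrum_pos {A : H →L[ℂ] H} (hA : StrictlyPos A) {x : ℝ} (hx : x ∈ spectrum ℝ A) :
    0 < x :=
  hA.isStrictlyPositive.spectrum_pos hx

theorem isSelfAdjoint {A : H →L[ℂ] H} (hA : StrictlyPos A) : IsSelfAdjoint A :=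
  hA.1.isSelfAdjoint

theorem opSqrt_mul_self {A : H →L[ℂ] H} (hA : StrictlyPos A) : opSqrt A * opSqrt A = A := by
  have := hA.isSelfAdjoint
  unfold opSqrt
  rw [← cfc_mul (R := ℝ) ..]
  conv_rhs => rw [← cfc_id ℝ A]
  exact cfc_congr fun x hx => Real.mul_self_sqrt (hA.spectrum_pos hx).le

theorem continuousOn_inv_sqrt {A : H →L[ℂ] H} (hA : StrictlyPos A) :
    ContinuousOn (fun x : ℝ => (Real.sqrt x)⁻¹) (spectrum ℝ A) :=
  Real.continuous_sqrt.continuousOn.inv₀ fun _ hx => (Real.sqrt_pos.2 (hA.spectrum_pos hx)).ne'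

theorem opInvSqrt_mul_opSqrt {A : H →L[ℂ] H} (hA : StrictlyPos A) :
    opInvSqrt A * opSqrt A = 1 := by
  have := hA.isSelfAdjoint
  have hc := hA.continuousOn_inv_sqrt
  unfold opSqrt opInvSqrt
  rw [← cfc_mul (R := ℝ) .., ← cfc_one ℝ A]
  exact cfc_congr fun x hx => inv_mul_cancel₀ (Real.sqrt_pos.2 (hA.spectrum_pos hx)).ne'

theorem opSqrt_mul_opInvSqrt {A : H →L[ℂ] H} (hA : StrictlyPos A) :
    opSqrt A * opInvSqrt A = 1 := by
  rw [← hA.opInvSqrt_mul_opSqrt, opSqrt, opInvSqrt]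
  exact cfc_commute_cfc ..

theorem conj {A B : H →L[ℂ] H} (hA : StrictlyPos A) (hB : StrictlyPos B) :
    StrictlyPos (opInvSqrt B * A * opInvSqrt B) := by
  have hsa : IsSelfAdjoint (opInvSqrt B) := cfc_predicate ..
  have hu : IsUnit (opInvSqrt B) :=
    ⟨⟨_, _, hB.opInvSqrt_mul_opSqrt, hB.opSqrt_mul_opInvSqrt⟩, rfl⟩
  refine of_isStrictlyPositive ⟨?_, (hu.mul hA.2).mul hu⟩
  simpa [hsa.star_eq] using star_left_conjugate_nonneg hA.isStrictlyPositive.nonneg (opInvSqrt B)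

theorem opSqrt_conj {A B : H →L[ℂ] H} (hB : StrictlyPos B) :
    opSqrt B * (opInvSqrt B * A * opInvSqrt B) * opSqrt B = A :=
  calc opSqrt B * (opInvSqrt B * A * opInvSqrt B) * opSqrt B
    _ = (opSqrt B * opInvSqrt B) * A * (opInvSqrt B * opSqrt B) := by noncomm_ring
    _ = A := by rw [hB.opSqrt_mul_opInvSqrt, hB.opInvSqrt_mul_opSqrt, one_mul, mul_one]

end StrictlyPos

section kernelPerspective

open Set

theorem continuousOn_mul_div_add :
    ContinuousOn (Function.uncurry fun l t : ℝ => t * l / (t + l)) (Ioi 0 ×ˢ Ioi 0) :=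
  ContinuousOn.div (by fun_prop) (by fun_prop) fun x hx => (add_pos hx.2 hx.1).ne'

theorem continuousOn_mul_div_add_right {l : ℝ} (hl : 0 < l) :
    ContinuousOn (fun t : ℝ => t * l / (t + l)) (Ioi 0) :=
  ContinuousOn.div (by fun_prop) (by fun_prop) fun _ hx => (add_pos hx hl).ne'

theorem norm_mul_div_add_le {K l t : ℝ} (hK : 1 ≤ K) (hl : 0 < l) (ht : 0 < t) (htK : t ≤ K) :
    ‖t * l / (t + l)‖ ≤ K * (l / (1 + l)) := by
  rw [Real.norm_of_nonneg (by positivity), mul_div_assoc', div_le_div_iff₀ (by positivity)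
    (by positivity)]
  nlinarith [mul_nonneg (mul_pos ht hl).le (sub_nonneg.2 hK),
    mul_nonneg (mul_pos hl hl).le (sub_nonneg.2 htK)]

theorem exists_bound_mul_div_add {T : H →L[ℂ] H} (hT : StrictlyPos T) :
    ∃ K : ℝ, ∀ l ∈ Ioi (0 : ℝ), ∀ t ∈ spectrum ℝ T,
      ‖t * l / (t + l)‖ ≤ K * (l / (1 + l)) := by
  obtain ⟨M, hM⟩ := (spectrum.isCompact (𝕜 := ℝ) T).bddAbove
  exact ⟨max 1 M, fun l hl t ht => norm_mul_div_add_le (le_max_left _ _) hl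
    (hT.spectrum_pos ht) ((hM ht).trans (le_max_right _ _))⟩

theorem integrableOn_cfc_mul_div_add {w : Measure ℝ}
    (hw : IntegrableOn (fun l => l / (1 + l)) (Ioi 0) w) {T : H →L[ℂ] H} (hT : StrictlyPos T) :
    IntegrableOn (fun l => cfc (fun t : ℝ => t * l / (t + l)) T) (Ioi 0) w := by
  have := hT.isSelfAdjoint
  obtain ⟨K, hK⟩ := exists_bound_mul_div_add hT
  exact integrableOn_cfc measurableSet_Ioi (fun l t => t * l / (t + l)) _ T
    (continuousOn_mul_div_add.mono (prod_mono_right fun _ => hT.spectrum_pos))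
    (ae_restrict_of_forall_mem measurableSet_Ioi hK) (hw.const_mul K).hasFiniteIntegral

theorem cfc_setIntegral_mul_div_add {w : Measure ℝ}
    (hw : IntegrableOn (fun l => l / (1 + l)) (Ioi 0) w) {T : H →L[ℂ] H} (hT : StrictlyPos T) :
    cfc (fun t : ℝ => ∫ l in Ioi 0, t * l / (t + l) ∂w) T =
      ∫ l in Ioi 0, cfc (fun t : ℝ => t * l / (t + l)) T ∂w := by
  have := hT.isSelfAdjoint
  obtain ⟨K, hK⟩ := exists_bound_mul_div_add hT
  exact cfc_setIntegral measurableSet_Ioi (fun l t => t * l / (t + l)) _ T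
    (continuousOn_mul_div_add.mono (prod_mono_right fun _ => hT.spectrum_pos))
    (ae_restrict_of_forall_mem measurableSet_Ioi hK) (hw.const_mul K).hasFiniteIntegral

theorem cfc_mul_div_add_mul {T : H →L[ℂ] H} (hT : StrictlyPos T) {l : ℝ} (hl : 0 < l) :
    cfc (fun t : ℝ => t * l / (t + l)) T * (T + l • 1) = l • T := by
  have := hT.isSelfAdjoint
  have hc := (continuousOn_mul_div_add_right hl).mono fun _ => hT.spectrum_pos
  have h1 : T + l • 1 = cfc (fun t : ℝ => t + l) T := by
    rw [cfc_add_const l (fun t : ℝ => t) T, cfc_id' ℝ T, Algebra.algebraMap_eq_smul_one]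
  rw [h1, ← cfc_mul .., ← cfc_const_mul_id l T]
  refine cfc_congr fun t ht => ?_
  have := (add_pos (hT.spectrum_pos ht) hl).ne'
  field_simp

/-- The perspective of `t ↦ t * l / (t + l)` is `X ↦ l • X (X + l Y)⁻¹ Y`. -/
theorem persp_mul_div_add {X Y : H →L[ℂ] H} (hX : StrictlyPos X) (hY : StrictlyPos Y) {l : ℝ}
    (hl : 0 < l) :
    persp (fun t => t * l / (t + l)) X Y = l • (X * Ring.inverse (X + l • Y) * Y) := by
  have hM : IsUnit (X + l • Y) := (hX.add (hY.smul hl)).2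
  have hk := cfc_mul_div_add_mul (hX.conj hY) hl
  set S := opSqrt Y with hS
  set R := opInvSqrt Y with hR
  set T := R * X * R with hT
  set K := cfc (fun t : ℝ => t * l / (t + l)) T with hK
  have hSS : S * S = Y := hY.opSqrt_mul_self
  have hSR : S * R = 1 := hY.opSqrt_mul_opInvSqrt
  have hRS : R * S = 1 := hY.opInvSqrt_mul_opSqrt
  have hSTS : S * T * S = X := hY.opSqrt_conj
  have hRM : R * (X + l • Y) = (T + l • 1) * S := by
    rw [← hSS, mul_add, mul_smul_comm, ← mul_assoc R S S, hRS, one_mul, add_mul, smul_mul_assoc,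
      one_mul, hT, mul_assoc _ R S, hRS, mul_one]
  have h : S * K * R = l • (X * Ring.inverse (X + l • Y)) := by
    calc S * K * R = S * K * R * ((X + l • Y) * Ring.inverse (X + l • Y)) := by
          rw [Ring.mul_inverse_cancel _ hM, mul_one]
      _ = S * (K * (T + l • 1)) * S * Ring.inverse (X + l • Y) := by
          rw [← mul_assoc, mul_assoc (S * K), hRM]
          simp only [mul_assoc]
      _ = l • (X * Ring.inverse (X + l • Y)) := by
          rw [hk, mul_smul_comm, smul_mul_assoc, hSTS, smul_mul_assoc]
  calc persp (fun t => t * l / (t + l)) X Y = S * K * (R * S) * S := by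
        rw [hRS, mul_one]; rfl
    _ = S * K * R * Y := by rw [← hSS]; simp only [mul_assoc]
    _ = l • (X * Ring.inverse (X + l • Y) * Y) := by rw [h, smul_mul_assoc]

theorem persp_mul_div_add_left {X Y : H →L[ℂ] H} (hX : StrictlyPos X) (hY : StrictlyPos Y)
    {l : ℝ} (hl : 0 < l) :
    persp (fun t => t * l / (t + l)) X Y =
      l • Y - l ^ 2 • (Y * Ring.inverse (X + l • Y) * Y) := by
  have h := Ring.mul_inverse_cancel _ (hX.add (hY.smul hl)).2
  rw [add_mul, ← eq_sub_iff_add_eq] at h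
  rw [persp_mul_div_add hX hY hl, h, sub_mul, one_mul, smul_sub, smul_mul_assoc, smul_mul_assoc,
    smul_smul, sq]

theorem persp_mul_div_add_right {X Y : H →L[ℂ] H} (hX : StrictlyPos X) (hY : StrictlyPos Y)
    {l : ℝ} (hl : 0 < l) :
    persp (fun t => t * l / (t + l)) X Y = X - X * Ring.inverse (X + l • Y) * X := by
  have h := Ring.inverse_mul_cancel _ (hX.add (hY.smul hl)).2
  rw [mul_add, ← eq_sub_iff_add_eq', mul_smul_comm] at h
  rw [persp_mul_div_add hX hY hl, mul_assoc, ← mul_smul_comm, h, mul_sub, mul_one, mul_assoc]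

theorem integrableOn_persp_mul_div_add {w : Measure ℝ}
    (hw : IntegrableOn (fun l => l / (1 + l)) (Ioi 0) w) {X Y : H →L[ℂ] H}
    (hX : StrictlyPos X) (hY : StrictlyPos Y) :
    IntegrableOn (fun l => persp (fun t => t * l / (t + l)) X Y) (Ioi 0) w :=
  ((integrableOn_cfc_mul_div_add hw (hX.conj hY)).const_mul (opSqrt Y)).mul_const (opSqrt Y)

theorem persp_eq_setIntegral {f : ℝ → ℝ} {a b : ℝ} {w : Measure ℝ}
    (hf : ContinuousOn f (Ioi 0))
    (hw : IntegrableOn (fun l => l / (1 + l)) (Ioi 0) w)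
    (hrep : ∀ t > (0 : ℝ), f t = a + b * t + ∫ l in Ioi 0, t * l / (t + l) ∂w)
    {X Y : H →L[ℂ] H} (hX : StrictlyPos X) (hY : StrictlyPos Y) :
    persp f X Y = b • X + a • Y +
      ∫ l in Ioi 0, persp (fun t => t * l / (t + l)) X Y ∂w := by
  have hT := hX.conj hY
  have hint := integrableOn_cfc_mul_div_add hw hT
  have hsts := hY.opSqrt_conj (A := X)
  have := hT.isSelfAdjoint
  unfold persp
  rw [integral_mul_const_of_integrable (hint.const_mul (opSqrt Y)),
    integral_const_mul_of_integrable hint]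
  set T := opInvSqrt Y * X * opInvSqrt Y with hTdef
  have hfc : ContinuousOn (fun t => f t - (a + b * t)) (spectrum ℝ T) :=
    (hf.mono fun _ => hT.spectrum_pos).sub (by fun_prop)
  have key : cfc f T = a • 1 + b • T +
      ∫ l in Ioi 0, cfc (fun t : ℝ => t * l / (t + l)) T ∂w := by
    rw [← cfc_setIntegral_mul_div_add hw hT, ← cfc_const_mul_id b T,
      ← Algebra.algebraMap_eq_smul_one, ← cfc_const_add a (fun t => b * t) T]
    rw [cfc_congr (g := fun t => (a + b * t) + (f t - (a + b * t))) (fun t _ => by ring),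
      cfc_add ..]
    congr 1
    refine cfc_congr fun t ht => ?_
    simp only [hrep t (hT.spectrum_pos ht), add_sub_cancel_left]
  rw [key, mul_add, mul_add, add_mul, add_mul, mul_smul_comm, mul_smul_comm, mul_one,
    smul_mul_assoc, smul_mul_assoc, hsts, hY.opSqrt_mul_self, add_comm (a • Y)]

theorem persp_mul_div_add_sub_left {X Z Y : H →L[ℂ] H} (hX : StrictlyPos X)
    (hZ : StrictlyPos Z) (hY : StrictlyPos Y) {l : ℝ} (hl : 0 < l) :
    l ^ 2 • (∫ t in (0 : ℝ)..1, Y * Ring.inverse ((1 - t) • Z + t • X + l • Y) * (X - Z) *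
        Ring.inverse ((1 - t) • Z + t • X + l • Y) * Y) =
      persp (fun t => t * l / (t + l)) X Y - persp (fun t => t * l / (t + l)) Z Y := by
  have h := integral_ringInverse_segment (Z + l • Y) (X + l • Y) Y Y
    fun t ht => ((hZ.add (hY.smul hl)).convexComb (hX.add (hY.smul hl)) ht).2
  have hseg (t : ℝ) : (1 - t) • (Z + l • Y) + t • (X + l • Y) =
      (1 - t) • Z + t • X + l • Y := by module
  simp only [hseg, add_sub_add_right_eq_sub] at h
  rw [h, persp_mul_div_add_left hX hY hl, persp_mul_div_add_left hZ hY hl, smul_sub,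
    sub_sub_sub_cancel_left]

theorem persp_mul_div_add_sub_right {X Y Z : H →L[ℂ] H} (hX : StrictlyPos X)
    (hY : StrictlyPos Y) (hZ : StrictlyPos Z) {l : ℝ} (hl : 0 < l) :
    l • (∫ t in (0 : ℝ)..1, X * Ring.inverse (X + l • ((1 - t) • Z + t • Y)) * (Y - Z) *
        Ring.inverse (X + l • ((1 - t) • Z + t • Y)) * X) =
      persp (fun t => t * l / (t + l)) X Y - persp (fun t => t * l / (t + l)) X Z := by
  have h := integral_ringInverse_segment (X + l • Z) (X + l • Y) X X
    fun t ht => ((hX.add (hZ.smul hl)).convexComb (hX.add (hY.smul hl)) ht).2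
  have hseg (t : ℝ) : (1 - t) • (X + l • Z) + t • (X + l • Y) =
      X + l • ((1 - t) • Z + t • Y) := by module
  simp only [hseg, add_sub_add_left_eq_sub, ← smul_sub, mul_smul_comm, smul_mul_assoc] at h
  rw [← intervalIntegral.integral_smul, h, persp_mul_div_add_right hX hY hl,
    persp_mul_div_add_right hX hZ hl, sub_sub_sub_cancel_left]

end kernelPerspective

/-- **Corollary 2.2.** If `f(t) = a + b t + ∫₀^∞ tλ/(t+λ) dw(λ)` on `(0,∞)`, then for all
strictly positive operators `A, B, C, D`,
`𝒫_f(A,B) - 𝒫_f(C,D) = b(A - C) + a(B - D)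
  + ∫₀^∞ λ² [∫₀¹ B((1-t)C + tA + λB)⁻¹ (A - C) ((1-t)C + tA + λB)⁻¹ B dt] dw(λ)
  + ∫₀^∞ λ [∫₀¹ C(C + λ((1-t)D + tB))⁻¹ (B - D) (C + λ((1-t)D + tB))⁻¹ C dt] dw(λ)`. -/
theorem stmt_5 (f : ℝ → ℝ) (a b : ℝ) (hb : 0 ≤ b) (w : Measure ℝ)
    (hf : ContinuousOn f (Set.Ioi 0))
    (hw : IntegrableOn (fun l => l / (1 + l)) (Set.Ioi 0) w)
    (hrep : ∀ t > (0:ℝ), f t = a + b * t + ∫ l in Set.Ioi 0, t * l / (t + l) ∂w)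
    (A B C D : H →L[ℂ] H) (hA : StrictlyPos A) (hB : StrictlyPos B)
    (hC : StrictlyPos C) (hD : StrictlyPos D) :
    persp f A B - persp f C D = b • (A - C) + a • (B - D) +
      (∫ l in Set.Ioi (0:ℝ), l ^ 2 •
        (∫ t in (0:ℝ)..1, B * Ring.inverse ((1 - t) • C + t • A + l • B) * (A - C) *
          Ring.inverse ((1 - t) • C + t • A + l • B) * B) ∂w) +
      ∫ l in Set.Ioi (0:ℝ), l •
        (∫ t in (0:ℝ)..1, C * Ring.inverse (C + l • ((1 - t) • D + t • B)) * (B - D) *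
          Ring.inverse (C + l • ((1 - t) • D + t • B)) * C) ∂w := by
  have hAB := integrableOn_persp_mul_div_add hw hA hB
  have hCB := integrableOn_persp_mul_div_add hw hC hB
  have hCD := integrableOn_persp_mul_div_add hw hC hD
  rw [setIntegral_congr_fun measurableSet_Ioi
      fun l hl => persp_mul_div_add_sub_left hA hC hB (Set.mem_Ioi.1 hl),
    setIntegral_congr_fun measurableSet_Ioi
      fun l hl => persp_mul_div_add_sub_right hC hB hD (Set.mem_Ioi.1 hl),
    integral_sub hAB hCB, integral_sub hCB hCD, persp_eq_setIntegral hf hw hrep hA hB,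
    persp_eq_setIntegral hf hw hrep hC hD, smul_sub, smul_sub]
  abel
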